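/- arXiv:2204.02272 — 4 statements merged into one kernel-verified Lean document; each statement's English description precedes it below -/
import Mathlib

section
/- There exists an absolute constant C > 0 such that the following holds. Let (Θ, 𝒜) be a measurable space, ψ₀ a probability measure on Θ, and Φ, Φ̂ : Θ → ℝ measurable functions with Φ ≥ 0 and Φ̂ ≥ 0. Set Z = ∫ exp(−Φ) dψ₀ and Ẑ = ∫ exp(−Φ̂) dψ₀, assume Z > 0 and Ẑ > 0, and define dψ = (1/Z) exp(−Φ) dψ₀. If (Φ − Φ̂)² is ψ-integrable and (Φ − Φ̂)⁴ is ψ₀-integrable, then the squared Hellinger distance satisfies (1/2) ∫ ( Z^{−1/2} exp(−Φ(θ)/2) − Ẑ^{−1/2} exp(−Φ̂(θ)/2) )² dψ₀(θ) ≤ C ∫ (Φ(θ) − Φ̂(θ))² dψ(θ) + (C/Z) ∫ (Φ(θ) − Φ̂(θ))⁴ dψ₀(θ). -/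
open MeasureTheory

/-- Pointwise comparison of square roots of Gibbs weights with nonnegative potentials. -/
lemma sq_exp_half_sub_exp_half_le {a b : ℝ} (ha : 0 ≤ a) (hb : 0 ≤ b) :
    (Real.exp (-a / 2) - Real.exp (-b / 2)) ^ 2
      ≤ (a - b) ^ 2 * Real.exp (-a) + (a - b) ^ 4 := by
  have hfa : Real.exp (-a / 2) ≤ 1 := Real.exp_le_one_iff.2 (by linarith)
  have hfb : Real.exp (-b / 2) ≤ 1 := Real.exp_le_one_iff.2 (by linarith)
  have hpa := Real.exp_pos (-a / 2)
  have hpb := Real.exp_pos (-b / 2)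
  by_cases h : |a - b| ≤ 1
  · have hexp : Real.exp (-b / 2) = Real.exp (-a / 2) * Real.exp ((a - b) / 2) := by
      rw [← Real.exp_add]; ring_nf
    have hsq : Real.exp (-a) = Real.exp (-a / 2) ^ 2 := by
      rw [← Real.exp_nat_mul]; push_cast; ring_nf
    have hlip : |Real.exp ((a - b) / 2) - 1| ≤ 2 * |(a - b) / 2| :=
      Real.abs_exp_sub_one_le (by rw [abs_div, abs_two]; linarith [abs_nonneg (a - b)])
    rw [abs_div, abs_two, mul_div_cancel₀ _ (two_ne_zero)] at hlip
    have hle : (Real.exp ((a - b) / 2) - 1) ^ 2 ≤ (a - b) ^ 2 := sq_le_sq.2 hlip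
    calc (Real.exp (-a / 2) - Real.exp (-b / 2)) ^ 2
        = (Real.exp ((a - b) / 2) - 1) ^ 2 * Real.exp (-a) := by rw [hexp, hsq]; ring
      _ ≤ (a - b) ^ 2 * Real.exp (-a) := by gcongr
      _ ≤ _ := le_add_of_nonneg_right (by positivity)
  · have h1 : 1 ≤ (a - b) ^ 2 := (one_le_sq_iff_one_le_abs _).2 (not_le.1 h).le
    have h2 : (Real.exp (-a / 2) - Real.exp (-b / 2)) ^ 2 ≤ 1 := by
      rw [sq_le_one_iff_abs_le_one, abs_le]
      constructor <;> linarith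
    have h3 : 0 ≤ (a - b) ^ 2 * Real.exp (-a) := by positivity
    nlinarith

/-- The squared distance of the normalizations of two nonnegative square-integrable functions is
controlled by the squared distance of the functions themselves. -/
lemma half_integral_sq_normalized_sub_le {Θ : Type*} [MeasurableSpace Θ] {μ : Measure Θ}
    {f g : Θ → ℝ} (hf : ∀ θ, 0 ≤ f θ) (hg : ∀ θ, 0 ≤ g θ)
    (hff : Integrable (fun θ => f θ ^ 2) μ) (hgg : Integrable (fun θ => g θ ^ 2) μ)
    (hfg : Integrable (fun θ => f θ * g θ) μ) {s t : ℝ} (hs : 0 < s) (ht : 0 < t)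
    (hfs : ∫ θ, f θ ^ 2 ∂μ = s ^ 2) (hgt : ∫ θ, g θ ^ 2 ∂μ = t ^ 2) :
    (1 / 2) * ∫ θ, (s⁻¹ * f θ - t⁻¹ * g θ) ^ 2 ∂μ ≤ (∫ θ, (f θ - g θ) ^ 2 ∂μ) / s ^ 2 := by
  have expand (x y : ℝ) : ∫ θ, (x * f θ - y * g θ) ^ 2 ∂μ
      = x ^ 2 * s ^ 2 + y ^ 2 * t ^ 2 - 2 * x * y * ∫ θ, f θ * g θ ∂μ := by
    rw [← hfs, ← hgt, ← integral_const_mul, ← integral_const_mul, ← integral_const_mul,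
      ← integral_add (hff.const_mul _) (hgg.const_mul _),
      ← integral_sub (by exact (hff.const_mul _).add (hgg.const_mul _)) (hfg.const_mul _)]
    congr 1 with θ
    ring
  have hdist := expand 1 1
  simp only [one_mul, one_pow, mul_one] at hdist
  have hnonneg : 0 ≤ ∫ θ, (s⁻¹ * f θ - t⁻¹ * g θ) ^ 2 ∂μ :=
    integral_nonneg fun θ => sq_nonneg _
  have hI : 0 ≤ ∫ θ, f θ * g θ ∂μ := integral_nonneg fun θ => mul_nonneg (hf θ) (hg θ)
  obtain ⟨c, hc⟩ : ∃ c, ∫ θ, f θ * g θ ∂μ = c * (s * t) :=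
    ⟨(∫ θ, f θ * g θ ∂μ) / (s * t), by field_simp⟩
  have hnorm : ∫ θ, (s⁻¹ * f θ - t⁻¹ * g θ) ^ 2 ∂μ = 2 - 2 * c := by
    rw [expand, hc]; field_simp; ring
  rw [hc] at hI hdist
  have hc0 : 0 ≤ c := nonneg_of_mul_nonneg_left hI (by positivity)
  have hc1 : c ≤ 1 := by linarith
  rw [hnorm, hdist, le_div_iff₀ (by positivity)]
  nlinarith [sq_nonneg (t - c * s), mul_nonneg (mul_nonneg hc0 (sub_nonneg.2 hc1)) (sq_nonneg s)]

/-- There exists an absolute constant `C > 0` such that for any measurable space `Θ`,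
probability measure `ψ₀`, nonnegative measurable potentials `Φ, Φ̂`, with positive evidences
`Z = ∫ exp (-Φ) dψ₀` and `Ẑ = ∫ exp (-Φ̂) dψ₀`, posterior `dψ = (1/Z) exp (-Φ) dψ₀`, and
suitable integrability, the squared Hellinger distance between the posterior and the
approximate posterior is bounded by
`C ∫ (Φ - Φ̂)² dψ + (C/Z) ∫ (Φ - Φ̂)⁴ dψ₀`. -/
theorem hellinger_bound_general :
    ∃ C : ℝ, 0 < C ∧
      ∀ (Θ : Type) [MeasurableSpace Θ] (ψ₀ : Measure Θ) [IsProbabilityMeasure ψ₀]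
        (Φ Φhat : Θ → ℝ), Measurable Φ → Measurable Φhat →
        (∀ θ, 0 ≤ Φ θ) → (∀ θ, 0 ≤ Φhat θ) →
        ∀ Z Zhat : ℝ,
          Z = ∫ θ, Real.exp (-(Φ θ)) ∂ψ₀ →
          Zhat = ∫ θ, Real.exp (-(Φhat θ)) ∂ψ₀ →
          0 < Z → 0 < Zhat →
          ∀ ψ : Measure Θ,
            ψ = ψ₀.withDensity (fun θ => ENNReal.ofReal (Real.exp (-(Φ θ)) / Z)) →
            Integrable (fun θ => (Φ θ - Φhat θ) ^ 2) ψ →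
            Integrable (fun θ => (Φ θ - Φhat θ) ^ 4) ψ₀ →
            (1 / 2) * ∫ θ, ((Real.sqrt Z)⁻¹ * Real.exp (-(Φ θ) / 2)
                - (Real.sqrt Zhat)⁻¹ * Real.exp (-(Φhat θ) / 2)) ^ 2 ∂ψ₀
              ≤ C * ∫ θ, (Φ θ - Φhat θ) ^ 2 ∂ψ
                + (C / Z) * ∫ θ, (Φ θ - Φhat θ) ^ 4 ∂ψ₀ := by
  refine ⟨1, one_pos, ?_⟩
  intro Θ _ ψ₀ _ Φ Φhat hΦ hΦhat hΦ0 hΦhat0 Z Zhat hZ hZhat hZpos hZhatpos ψ hψ h2 h4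
  have hsq (x : ℝ) : Real.exp (-x / 2) ^ 2 = Real.exp (-x) := by
    rw [← Real.exp_nat_mul]; push_cast; ring_nf
  have bdd {u : Θ → ℝ} (hu : Measurable u) (hu0 : ∀ θ, 0 ≤ u θ) (hu1 : ∀ θ, u θ ≤ 1) :
      Integrable u ψ₀ :=
    Integrable.of_bound hu.aestronglyMeasurable 1
      (ae_of_all _ fun θ => by rw [Real.norm_of_nonneg (hu0 θ)]; exact hu1 θ)
  have exp_le {x : ℝ} (hx : 0 ≤ x) : Real.exp (-x / 2) ≤ 1 :=
    Real.exp_le_one_iff.2 (by linarith)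
  have hdens : Measurable fun θ => ENNReal.ofReal (Real.exp (-(Φ θ)) / Z) := by fun_prop
  have htoReal (θ : Θ) : (ENNReal.ofReal (Real.exp (-(Φ θ)) / Z)).toReal
      = Real.exp (-(Φ θ)) / Z := ENNReal.toReal_ofReal (by positivity)
  have hint : Integrable (fun θ => (Φ θ - Φhat θ) ^ 2 * Real.exp (-(Φ θ))) ψ₀ := by
    rw [hψ, integrable_withDensity_iff hdens (by simp)] at h2
    refine (h2.mul_const Z).congr (ae_of_all _ fun θ => ?_)
    simp only [htoReal]
    field_simp
  have hψint : ∫ θ, (Φ θ - Φhat θ) ^ 2 ∂ψ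
      = (∫ θ, (Φ θ - Φhat θ) ^ 2 * Real.exp (-(Φ θ)) ∂ψ₀) / Z := by
    rw [hψ, integral_withDensity_eq_integral_toReal_smul hdens (by simp), ← integral_div]
    congr 1 with θ
    rw [htoReal, smul_eq_mul]
    ring
  have hnormalized := half_integral_sq_normalized_sub_le (μ := ψ₀)
    (f := fun θ => Real.exp (-(Φ θ) / 2)) (g := fun θ => Real.exp (-(Φhat θ) / 2))
    (fun θ => (Real.exp_pos _).le) (fun θ => (Real.exp_pos _).le)
    (bdd (by fun_prop) (fun θ => by positivity)
      fun θ => pow_le_one₀ (Real.exp_pos _).le (exp_le (hΦ0 θ)))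
    (bdd (by fun_prop) (fun θ => by positivity)
      fun θ => pow_le_one₀ (Real.exp_pos _).le (exp_le (hΦhat0 θ)))
    (bdd (by fun_prop) (fun θ => by positivity)
      fun θ => mul_le_one₀ (exp_le (hΦ0 θ)) (Real.exp_pos _).le (exp_le (hΦhat0 θ)))
    (Real.sqrt_pos.2 hZpos) (Real.sqrt_pos.2 hZhatpos)
    (by simp only [hsq]; rw [Real.sq_sqrt hZpos.le, hZ])
    (by simp only [hsq]; rw [Real.sq_sqrt hZhatpos.le, hZhat])
  rw [Real.sq_sqrt hZpos.le] at hnormalized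
  refine hnormalized.trans ?_
  have hpointwise : ∫ θ, (Real.exp (-(Φ θ) / 2) - Real.exp (-(Φhat θ) / 2)) ^ 2 ∂ψ₀
      ≤ ∫ θ, ((Φ θ - Φhat θ) ^ 2 * Real.exp (-(Φ θ)) + (Φ θ - Φhat θ) ^ 4) ∂ψ₀ :=
    integral_mono_of_nonneg (ae_of_all _ fun θ => sq_nonneg _) (hint.add h4)
      (ae_of_all _ fun θ => sq_exp_half_sub_exp_half_le (hΦ0 θ) (hΦhat0 θ))
  rw [integral_add hint h4] at hpointwise
  rw [hψint, one_mul, one_div_mul_eq_div, ← add_div]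
  gcongr
end

section
/- For every B ≥ 0 there exists a constant C > 0 (depending only on B) such that the following holds. Let (Θ, 𝒜) be a measurable space, ψ₀ a probability measure on Θ, and Φ, Φ̂ : Θ → ℝ measurable functions with 0 ≤ Φ ≤ B ψ₀-almost surely and Φ̂ ≥ 0. Set Z = ∫ exp(−Φ) dψ₀ and Ẑ = ∫ exp(−Φ̂) dψ₀ (both positive), and define dψ = (1/Z) exp(−Φ) dψ₀. If (Φ − Φ̂)² and (Φ − Φ̂)⁴ are ψ-integrable, then (1/2) ∫ ( Z^{−1/2} exp(−Φ(θ)/2) − Ẑ^{−1/2} exp(−Φ̂(θ)/2) )² dψ₀(θ) ≤ C ∫ (Φ(θ) − Φ̂(θ))² dψ(θ) + C ∫ (Φ(θ) − Φ̂(θ))⁴ dψ(θ). -/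
open MeasureTheory

/-- The exponential `exp (-x / 2)` is `1 / 2`-Lipschitz on the nonnegative reals, squared form. -/
lemma sq_exp_neg_half_sub_le {x y : ℝ} (hx : 0 ≤ x) (hy : 0 ≤ y) :
    (Real.exp (-x / 2) - Real.exp (-y / 2)) ^ 2 ≤ (x - y) ^ 2 / 4 := by
  wlog hxy : x ≤ y generalizing x y
  · have := this hy hx (le_of_not_ge hxy)
    nlinarith
  have hmono : Real.exp (-y / 2) ≤ Real.exp (-x / 2) := Real.exp_le_exp.mpr (by linarith)
  have hone : Real.exp (-x / 2) ≤ 1 := Real.exp_le_one_iff.mpr (by linarith)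
  have hpos := Real.exp_pos (-x / 2)
  have hsplit : Real.exp (-y / 2) = Real.exp (-x / 2) * Real.exp ((x - y) / 2) := by
    rw [← Real.exp_add]; congr 1; ring
  have hlin := Real.add_one_le_exp ((x - y) / 2)
  have hle : Real.exp (-x / 2) - Real.exp (-y / 2) ≤ (y - x) / 2 := by
    rw [hsplit]; nlinarith
  nlinarith

lemma sq_exp_neg_half (x : ℝ) : Real.exp (-x / 2) ^ 2 = Real.exp (-x) := by
  rw [← Real.exp_nat_mul]; congr 1; push_cast; ring

/-- If `c ∈ [0, 1]` is the cosine of the angle between vectors of lengths `a` and `b`, then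
`1 - c` is at most their squared distance divided by `a ^ 2`. -/
lemma sq_mul_one_sub_le {a b c : ℝ} (hc0 : 0 ≤ c) (hc1 : c ≤ 1) :
    a ^ 2 * (1 - c) ≤ a ^ 2 + b ^ 2 - 2 * (a * b * c) := by
  nlinarith [sq_nonneg (b - a * c), mul_nonneg (sq_nonneg a) (mul_nonneg hc0 (sub_nonneg.mpr hc1))]

/-- Integral of the square of a linear combination. -/
lemma integral_sq_mul_sub_mul {Θ : Type*} [MeasurableSpace Θ] {μ : Measure Θ} {f g : Θ → ℝ}
    (hf : Integrable (fun θ => f θ ^ 2) μ) (hg : Integrable (fun θ => g θ ^ 2) μ)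
    (hfg : Integrable (fun θ => f θ * g θ) μ) (s t : ℝ) :
    ∫ θ, (s * f θ - t * g θ) ^ 2 ∂μ
      = s ^ 2 * ∫ θ, f θ ^ 2 ∂μ + t ^ 2 * ∫ θ, g θ ^ 2 ∂μ
        - 2 * s * t * ∫ θ, f θ * g θ ∂μ := by
  rw [← integral_const_mul, ← integral_const_mul, ← integral_const_mul,
    ← integral_add (hf.const_mul _) (hg.const_mul _),
    ← integral_sub (f := fun θ => s ^ 2 * f θ ^ 2 + t ^ 2 * g θ ^ 2)
      ((hf.const_mul _).add (hg.const_mul _)) (hfg.const_mul _)]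
  congr 1
  ext θ
  ring

/-- For every bound `B ≥ 0` there is a constant `C > 0` (depending only on `B`) such that,
whenever the potential `Φ` satisfies `0 ≤ Φ ≤ B` `ψ₀`-a.s. and `Φ̂ ≥ 0`, the squared
Hellinger distance between the posterior `dψ = (1/Z) exp (-Φ) dψ₀` and the approximate
posterior is bounded by `C ∫ (Φ - Φ̂)² dψ + C ∫ (Φ - Φ̂)⁴ dψ`. -/
theorem hellinger_bound_bounded_potential :
    ∀ B : ℝ, 0 ≤ B →
    ∃ C : ℝ, 0 < C ∧
      ∀ (Θ : Type) [MeasurableSpace Θ] (ψ₀ : Measure Θ) [IsProbabilityMeasure ψ₀]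
        (Φ Φhat : Θ → ℝ), Measurable Φ → Measurable Φhat →
        (∀ θ, 0 ≤ Φ θ) → (∀ᵐ θ ∂ψ₀, Φ θ ≤ B) → (∀ θ, 0 ≤ Φhat θ) →
        ∀ Z Zhat : ℝ,
          Z = ∫ θ, Real.exp (-(Φ θ)) ∂ψ₀ →
          Zhat = ∫ θ, Real.exp (-(Φhat θ)) ∂ψ₀ →
          0 < Z → 0 < Zhat →
          ∀ ψ : Measure Θ,
            ψ = ψ₀.withDensity (fun θ => ENNReal.ofReal (Real.exp (-(Φ θ)) / Z)) →
            Integrable (fun θ => (Φ θ - Φhat θ) ^ 2) ψ →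
            Integrable (fun θ => (Φ θ - Φhat θ) ^ 4) ψ →
            (1 / 2) * ∫ θ, ((Real.sqrt Z)⁻¹ * Real.exp (-(Φ θ) / 2)
                - (Real.sqrt Zhat)⁻¹ * Real.exp (-(Φhat θ) / 2)) ^ 2 ∂ψ₀
              ≤ C * ∫ θ, (Φ θ - Φhat θ) ^ 2 ∂ψ
                + C * ∫ θ, (Φ θ - Φhat θ) ^ 4 ∂ψ := by
  intro B hB
  refine ⟨Real.exp B, Real.exp_pos B, ?_⟩
  intro Θ _ ψ₀ _ Φ Φhat hΦ hΦhat hΦ0 hΦB hΦhat0 Z Zhat hZ hZhat hZpos hZhatpos ψ hψ hint2 _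
  have hbdd : ∀ h : Θ → ℝ, Measurable h → (∀ θ, 0 ≤ h θ) →
      Integrable (fun θ => Real.exp (-(h θ))) ψ₀ := fun h hm h0 =>
    Integrable.of_bound (hm.neg.exp).aestronglyMeasurable 1
      (Filter.Eventually.of_forall fun θ => by
        rw [Real.norm_of_nonneg (Real.exp_pos _).le]
        exact Real.exp_le_one_iff.mpr (neg_nonpos.mpr (h0 θ)))
  have hf : Integrable (fun θ => Real.exp (-(Φ θ) / 2) ^ 2) ψ₀ := by
    simpa only [sq_exp_neg_half] using hbdd Φ hΦ hΦ0
  have hg : Integrable (fun θ => Real.exp (-(Φhat θ) / 2) ^ 2) ψ₀ := by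
    simpa only [sq_exp_neg_half] using hbdd Φhat hΦhat hΦhat0
  have hfg : Integrable (fun θ => Real.exp (-(Φ θ) / 2) * Real.exp (-(Φhat θ) / 2)) ψ₀ := by
    refine (hbdd (fun θ => (Φ θ + Φhat θ) / 2) ((hΦ.add hΦhat).div_const 2)
      fun θ => by linarith [hΦ0 θ, hΦhat0 θ]).congr (Filter.Eventually.of_forall fun θ => ?_)
    simp only [← Real.exp_add]
    congr 1
    ring
  have hZ' : ∫ θ, Real.exp (-(Φ θ) / 2) ^ 2 ∂ψ₀ = Z := by simp only [sq_exp_neg_half, hZ]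
  have hZhat' : ∫ θ, Real.exp (-(Φhat θ) / 2) ^ 2 ∂ψ₀ = Zhat := by
    simp only [sq_exp_neg_half, hZhat]
  set I := ∫ θ, Real.exp (-(Φ θ) / 2) * Real.exp (-(Φhat θ) / 2) ∂ψ₀ with hI
  have hI0 : 0 ≤ I := integral_nonneg fun θ => by positivity
  have ha : 0 < √Z := Real.sqrt_pos.mpr hZpos
  have hb : 0 < √Zhat := Real.sqrt_pos.mpr hZhatpos
  have ha2 : √Z ^ 2 = Z := Real.sq_sqrt hZpos.le
  have hb2 : √Zhat ^ 2 = Zhat := Real.sq_sqrt hZhatpos.le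
  obtain ⟨c, hc⟩ : ∃ c, c = I / (√Z * √Zhat) := ⟨_, rfl⟩
  have hIc : I = √Z * √Zhat * c := by rw [hc]; field_simp
  have hc0 : 0 ≤ c := by rw [hc]; positivity
  have hHell : ∫ θ, ((√Z)⁻¹ * Real.exp (-(Φ θ) / 2)
      - (√Zhat)⁻¹ * Real.exp (-(Φhat θ) / 2)) ^ 2 ∂ψ₀ = 2 * (1 - c) := by
    rw [integral_sq_mul_sub_mul hf hg hfg, hZ', hZhat', ← hI, hIc, inv_pow, inv_pow, ha2, hb2]
    field_simp
    ring
  have hc1 : c ≤ 1 := by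
    have : 0 ≤ ∫ θ, ((√Z)⁻¹ * Real.exp (-(Φ θ) / 2)
      - (√Zhat)⁻¹ * Real.exp (-(Φhat θ) / 2)) ^ 2 ∂ψ₀ := integral_nonneg fun θ => sq_nonneg _
    linarith
  have hdist : ∫ θ, (Real.exp (-(Φ θ) / 2) - Real.exp (-(Φhat θ) / 2)) ^ 2 ∂ψ₀
      = Z + Zhat - 2 * I := by
    have := integral_sq_mul_sub_mul hf hg hfg 1 1
    rw [hZ', hZhat', ← hI] at this
    simpa using this
  have hkey : Z * (1 - c)
      ≤ ∫ θ, (Real.exp (-(Φ θ) / 2) - Real.exp (-(Φhat θ) / 2)) ^ 2 ∂ψ₀ := by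
    rw [hdist, hIc]
    simpa only [ha2, hb2] using sq_mul_one_sub_le (a := √Z) (b := √Zhat) hc0 hc1
  have hdm : Measurable fun θ => ENNReal.ofReal (Real.exp (-(Φ θ)) / Z) :=
    (hΦ.neg.exp.div_const Z).ennreal_ofReal
  have hdlt : ∀ᵐ θ ∂ψ₀, ENNReal.ofReal (Real.exp (-(Φ θ)) / Z) < ⊤ :=
    Filter.Eventually.of_forall fun θ => ENNReal.ofReal_lt_top
  have hreal : ∀ θ, (ENNReal.ofReal (Real.exp (-(Φ θ)) / Z)).toReal = Real.exp (-(Φ θ)) / Z :=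
    fun θ => ENNReal.toReal_ofReal (by positivity)
  have hint : Integrable (fun θ => Real.exp (-(Φ θ)) / Z * (Φ θ - Φhat θ) ^ 2) ψ₀ := by
    rw [hψ, integrable_withDensity_iff_integrable_smul' hdm hdlt] at hint2
    simpa only [hreal, smul_eq_mul] using hint2
  have hval : ∫ θ, (Φ θ - Φhat θ) ^ 2 ∂ψ
      = ∫ θ, Real.exp (-(Φ θ)) / Z * (Φ θ - Φhat θ) ^ 2 ∂ψ₀ := by
    rw [hψ, integral_withDensity_eq_integral_toReal_smul hdm hdlt]
    simp only [hreal, smul_eq_mul]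
  have hle : ∫ θ, (Real.exp (-(Φ θ) / 2) - Real.exp (-(Φhat θ) / 2)) ^ 2 ∂ψ₀
      ≤ Z * Real.exp B * ∫ θ, (Φ θ - Φhat θ) ^ 2 ∂ψ := by
    rw [hval, ← integral_const_mul]
    refine integral_mono_of_nonneg (Filter.Eventually.of_forall fun θ => sq_nonneg _)
      (hint.const_mul _) ?_
    filter_upwards [hΦB] with θ hθ
    have h1 := sq_exp_neg_half_sub_le (hΦ0 θ) (hΦhat0 θ)
    have h2 : 1 ≤ Real.exp B * Real.exp (-(Φ θ)) := by
      rw [← Real.exp_add]; exact Real.one_le_exp (by linarith)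
    have h3 : Z * Real.exp B * (Real.exp (-(Φ θ)) / Z * (Φ θ - Φhat θ) ^ 2)
        = Real.exp B * Real.exp (-(Φ θ)) * (Φ θ - Φhat θ) ^ 2 := by
      field_simp
    rw [h3]
    nlinarith [sq_nonneg (Φ θ - Φhat θ)]
  have hfour : 0 ≤ Real.exp B * ∫ θ, (Φ θ - Φhat θ) ^ 4 ∂ψ :=
    mul_nonneg (Real.exp_pos B).le (integral_nonneg fun θ => by positivity)
  have hfin : 1 - c ≤ Real.exp B * ∫ θ, (Φ θ - Φhat θ) ^ 2 ∂ψ := by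
    refine le_of_mul_le_mul_left ?_ hZpos
    linarith
  rw [hHell]
  linarith
end

section
/- Let (Θ, 𝒜) be a measurable space, ψ₀ a probability measure on Θ, and Φ, Φ̂ : Θ → ℝ measurable functions with Φ ≥ 0 and Φ̂ ≥ 0. Set Z = ∫ exp(−Φ) dψ₀ and Ẑ = ∫ exp(−Φ̂) dψ₀ and assume Z > 0 and Ẑ > 0. Then Ẑ · ( Z^{−1/2} − Ẑ^{−1/2} )² ≤ (1/Z²) ∫ ( exp(−Φ(θ)) − exp(−Φ̂(θ)) )² dψ₀(θ). -/
open MeasureTheory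

/-- The square of the mean is at most the mean of the square. -/
lemma sq_integral_le_integral_sq {Ω : Type*} [MeasurableSpace Ω] {μ : Measure Ω}
    [IsProbabilityMeasure μ] {X : Ω → ℝ} (hX : MemLp X 2 μ) :
    (∫ ω, X ω ∂μ) ^ 2 ≤ ∫ ω, X ω ^ 2 ∂μ := by
  have h := ProbabilityTheory.variance_nonneg X μ
  rw [ProbabilityTheory.variance_eq_sub hX] at h
  simpa using h

lemma memLp_exp_neg {Ω : Type*} [MeasurableSpace Ω] (μ : Measure Ω) [IsFiniteMeasure μ]
    {f : Ω → ℝ} (hf : Measurable f) (hf0 : ∀ ω, 0 ≤ f ω) (p : ENNReal) :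
    MemLp (fun ω => Real.exp (-(f ω))) p μ :=
  MemLp.of_bound hf.neg.exp.aestronglyMeasurable 1 <| .of_forall fun ω => by
    simpa using hf0 ω

lemma mul_sq_inv_sqrt_sub_inv_sqrt_le {a b : ℝ} (ha : 0 < a) (hb : 0 < b) :
    b * ((Real.sqrt a)⁻¹ - (Real.sqrt b)⁻¹) ^ 2 ≤ 1 / a ^ 2 * (a - b) ^ 2 := by
  obtain ⟨x, hx, rfl⟩ : ∃ x : ℝ, 0 < x ∧ x ^ 2 = a :=
    ⟨√a, Real.sqrt_pos.2 ha, Real.sq_sqrt ha.le⟩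
  obtain ⟨y, hy, rfl⟩ : ∃ y : ℝ, 0 < y ∧ y ^ 2 = b :=
    ⟨√b, Real.sqrt_pos.2 hb, Real.sq_sqrt hb.le⟩
  rw [Real.sqrt_sq hx.le, Real.sqrt_sq hy.le]
  calc y ^ 2 * (x⁻¹ - y⁻¹) ^ 2 = 1 / (x ^ 2) ^ 2 * ((x - y) ^ 2 * x ^ 2) := by
        field_simp
        ring
    _ ≤ 1 / (x ^ 2) ^ 2 * ((x - y) ^ 2 * (x + y) ^ 2) := by
        gcongr
        linarith
    _ = 1 / (x ^ 2) ^ 2 * (x ^ 2 - y ^ 2) ^ 2 := by ring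

/-- For nonnegative measurable potentials `Φ, Φ̂` with positive evidences
`Z = ∫ exp (-Φ) dψ₀` and `Ẑ = ∫ exp (-Φ̂) dψ₀`, the normalisation-constant contribution
to the Hellinger distance satisfies
`Ẑ (Z^{-1/2} - Ẑ^{-1/2})² ≤ (1/Z²) ∫ (exp (-Φ) - exp (-Φ̂))² dψ₀`. -/
theorem evidence_term_bound {Θ : Type*} [MeasurableSpace Θ]
    (ψ₀ : Measure Θ) [IsProbabilityMeasure ψ₀] (Φ Φhat : Θ → ℝ)
    (hΦ : Measurable Φ) (hΦhat : Measurable Φhat)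
    (hΦ0 : ∀ θ, 0 ≤ Φ θ) (hΦhat0 : ∀ θ, 0 ≤ Φhat θ)
    (Z Zhat : ℝ)
    (hZ : Z = ∫ θ, Real.exp (-(Φ θ)) ∂ψ₀)
    (hZhat : Zhat = ∫ θ, Real.exp (-(Φhat θ)) ∂ψ₀)
    (hZpos : 0 < Z) (hZhatpos : 0 < Zhat) :
    Zhat * ((Real.sqrt Z)⁻¹ - (Real.sqrt Zhat)⁻¹) ^ 2
      ≤ (1 / Z ^ 2) * ∫ θ, (Real.exp (-(Φ θ)) - Real.exp (-(Φhat θ))) ^ 2 ∂ψ₀ := by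
  have hf := memLp_exp_neg ψ₀ hΦ hΦ0 2
  have hg := memLp_exp_neg ψ₀ hΦhat hΦhat0 2
  refine (mul_sq_inv_sqrt_sub_inv_sqrt_le hZpos hZhatpos).trans ?_
  gcongr
  rw [hZ, hZhat, ← integral_sub (hf.integrable one_le_two) (hg.integrable one_le_two)]
  exact sq_integral_le_integral_sq (hf.sub hg)
end

section
/- Let (Θ, 𝒜) be a measurable space, ψ₀ a probability measure on Θ, and Φ, Φ̂ : Θ → ℝ measurable functions with Φ ≥ 0 and Φ̂ ≥ 0. Set Z = ∫ exp(−Φ) dψ₀, assume Z > 0, and define dψ = (1/Z) exp(−Φ) dψ₀. If (Φ − Φ̂)² is ψ-integrable and (Φ − Φ̂)⁴ is ψ₀-integrable, then ∫ ( 1 − exp( (Φ(θ) − Φ̂(θ))/2 ) )² dψ(θ) ≤ (1/2) ∫ (Φ(θ) − Φ̂(θ))² dψ(θ) + (1/(32 Z)) ∫ (Φ(θ) − Φ̂(θ))⁴ dψ₀(θ). -/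
open MeasureTheory

/-- Second-order Taylor bound with the remainder controlled by the exponential itself. -/
lemma Real.exp_le_one_add_add_sq_mul_exp {x : ℝ} (hx : 0 ≤ x) :
    Real.exp x ≤ 1 + x + x ^ 2 / 2 * Real.exp x := by
  let g : ℝ → ℝ := fun y => Real.exp (-y) * (1 + y) + y ^ 2 / 2
  have hd (y : ℝ) : HasDerivAt g (y * (1 - Real.exp (-y))) y := by
    have h := (((hasDerivAt_id y).neg.exp).mul ((hasDerivAt_id y).const_add 1)).add
      (((hasDerivAt_id y).pow 2).div_const 2)
    refine h.congr_deriv ?_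
    simp
    ring
  have hmono : MonotoneOn g (Set.Ici 0) := by
    refine monotoneOn_of_hasDerivWithinAt_nonneg (convex_Ici 0)
      (fun y _ => (hd y).continuousAt.continuousWithinAt)
      (fun y _ => (hd y).hasDerivWithinAt) fun y hy => ?_
    have hy0 : 0 ≤ y := interior_subset hy
    exact mul_nonneg hy0 (sub_nonneg.2 (Real.exp_le_one_iff.2 (neg_nonpos.2 hy0)))
  have h : 1 ≤ Real.exp (-x) * (1 + x) + x ^ 2 / 2 := by
    simpa [g] using hmono Set.self_mem_Ici hx hx
  have h1 : Real.exp x * Real.exp (-x) = 1 := by rw [← Real.exp_add]; simp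
  calc Real.exp x ≤ Real.exp x * (Real.exp (-x) * (1 + x) + x ^ 2 / 2) :=
        le_mul_of_one_le_right (Real.exp_pos x).le h
    _ = 1 + x + x ^ 2 / 2 * Real.exp x := by linear_combination (1 + x) * h1

lemma one_sub_exp_half_sq_le (d : ℝ) :
    (1 - Real.exp (d / 2)) ^ 2
      ≤ 1 / 2 * d ^ 2 + 1 / 32 * (Real.exp (max d 0) * d ^ 4) := by
  rcases le_total d 0 with hd | hd
  · have h1 : Real.exp (d / 2) ≤ 1 := Real.exp_le_one_iff.2 (by linarith)
    have h2 := Real.add_one_le_exp (d / 2)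
    have h3 : (1 - Real.exp (d / 2)) ^ 2 ≤ (-d / 2) ^ 2 :=
      pow_le_pow_left₀ (by linarith) (by linarith) 2
    have h4 : 0 ≤ Real.exp (max d 0) * d ^ 4 := by positivity
    nlinarith [sq_nonneg d]
  · rw [max_eq_left hd]
    have h1 := Real.one_le_exp (x := d / 2) (by linarith)
    have h2 := Real.exp_le_one_add_add_sq_mul_exp (x := d / 2) (by linarith)
    have he : Real.exp d = Real.exp (d / 2) ^ 2 := by
      rw [← Real.exp_nat_mul]
      congr 1
      push_cast
      ring
    rw [he]
    set e := Real.exp (d / 2)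
    calc (1 - e) ^ 2 = (e - 1) ^ 2 := by ring
      _ ≤ (d / 2 + d ^ 2 / 8 * e) ^ 2 :=
        pow_le_pow_left₀ (by linarith) (by linarith) 2
      _ ≤ 1 / 2 * d ^ 2 + 1 / 32 * (e ^ 2 * d ^ 4) := by
        linarith [sq_nonneg (d / 2 - d ^ 2 / 8 * e)]

/-- For nonnegative measurable potentials `Φ, Φ̂`, positive evidence `Z = ∫ exp (-Φ) dψ₀`,
and posterior `dψ = (1/Z) exp (-Φ) dψ₀`, under suitable integrability,
`∫ (1 - exp ((Φ - Φ̂)/2))² dψ ≤ (1/2) ∫ (Φ - Φ̂)² dψ + (1/(32 Z)) ∫ (Φ - Φ̂)⁴ dψ₀`. -/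
theorem I1_term_bound {Θ : Type*} [MeasurableSpace Θ]
    (ψ₀ : Measure Θ) [IsProbabilityMeasure ψ₀] (Φ Φhat : Θ → ℝ)
    (hΦ : Measurable Φ) (hΦhat : Measurable Φhat)
    (hΦ0 : ∀ θ, 0 ≤ Φ θ) (hΦhat0 : ∀ θ, 0 ≤ Φhat θ)
    (Z : ℝ) (hZ : Z = ∫ θ, Real.exp (-(Φ θ)) ∂ψ₀) (hZpos : 0 < Z)
    (ψ : Measure Θ)
    (hψ : ψ = ψ₀.withDensity (fun θ => ENNReal.ofReal (Real.exp (-(Φ θ)) / Z)))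
    (hint2 : Integrable (fun θ => (Φ θ - Φhat θ) ^ 2) ψ)
    (hint4 : Integrable (fun θ => (Φ θ - Φhat θ) ^ 4) ψ₀) :
    ∫ θ, (1 - Real.exp ((Φ θ - Φhat θ) / 2)) ^ 2 ∂ψ
      ≤ (1 / 2) * ∫ θ, (Φ θ - Φhat θ) ^ 2 ∂ψ
        + (1 / (32 * Z)) * ∫ θ, (Φ θ - Φhat θ) ^ 4 ∂ψ₀ := by
  let d : Θ → ℝ := fun θ => Φ θ - Φhat θ
  have hd : Measurable d := hΦ.sub hΦhat
  let w : Θ → ℝ := fun θ => Real.exp (-(Φ θ)) / Z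
  have hw : Measurable w := (Real.measurable_exp.comp hΦ.neg).div_const Z
  have hw0 (θ : Θ) : 0 ≤ w θ := by positivity
  let r : Θ → ℝ := fun θ => Real.exp (max (d θ) 0) * d θ ^ 4
  have hr : Measurable r :=
    (Real.measurable_exp.comp (hd.max measurable_const)).mul (hd.pow_const 4)
  have hr0 (θ : Θ) : 0 ≤ r θ := by positivity
  have hle (θ : Θ) : w θ * r θ ≤ 1 / Z * d θ ^ 4 := by
    have h : Real.exp (-(Φ θ)) * Real.exp (max (d θ) 0) ≤ 1 := by
      rw [← Real.exp_add, Real.exp_le_one_iff, neg_add_le_iff_le_add, add_zero]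
      exact max_le (sub_le_self _ (hΦhat0 θ)) (hΦ0 θ)
    calc w θ * r θ
        = Real.exp (-(Φ θ)) * Real.exp (max (d θ) 0) * (1 / Z * d θ ^ 4) := by
          simp only [w, r]; ring
      _ ≤ 1 / Z * d θ ^ 4 := mul_le_of_le_one_left (by positivity) h
  have hint4' : Integrable (fun θ => 1 / Z * d θ ^ 4) ψ₀ := hint4.const_mul _
  have hwr : Integrable (fun θ => w θ * r θ) ψ₀ :=
    hint4'.mono' (hw.mul hr).aestronglyMeasurable <| ae_of_all _ fun θ => by
      rw [Real.norm_of_nonneg (mul_nonneg (hw0 θ) (hr0 θ))]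
      exact hle θ
  have hrψ : Integrable r ψ := by
    rw [hψ, integrable_withDensity_iff_integrable_smul' hw.ennreal_ofReal
      (ae_of_all _ fun _ => ENNReal.ofReal_lt_top)]
    refine hwr.congr (ae_of_all _ fun θ => ?_)
    simp only [smul_eq_mul]
    rw [ENNReal.toReal_ofReal (hw0 θ)]
  have hrint : ∫ θ, r θ ∂ψ ≤ 1 / Z * ∫ θ, d θ ^ 4 ∂ψ₀ := by
    rw [hψ, integral_withDensity_eq_integral_toReal_smul hw.ennreal_ofReal
      (ae_of_all _ fun _ => ENNReal.ofReal_lt_top), ← integral_const_mul]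
    refine (integral_congr_ae (ae_of_all _ fun θ => ?_)).trans_le
      (integral_mono hwr hint4' hle)
    simp only [smul_eq_mul]
    rw [ENNReal.toReal_ofReal (hw0 θ)]
  calc ∫ θ, (1 - Real.exp (d θ / 2)) ^ 2 ∂ψ
      ≤ ∫ θ, (1 / 2 * d θ ^ 2 + 1 / 32 * r θ) ∂ψ :=
        integral_mono_of_nonneg (ae_of_all _ fun _ => sq_nonneg _)
          ((hint2.const_mul _).add (hrψ.const_mul _))
          (ae_of_all _ fun θ => one_sub_exp_half_sq_le (d θ))
    _ = 1 / 2 * ∫ θ, d θ ^ 2 ∂ψ + 1 / 32 * ∫ θ, r θ ∂ψ := by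
        rw [integral_add (hint2.const_mul _) (hrψ.const_mul _), integral_const_mul,
          integral_const_mul]
    _ ≤ 1 / 2 * ∫ θ, d θ ^ 2 ∂ψ + 1 / 32 * (1 / Z * ∫ θ, d θ ^ 4 ∂ψ₀) := by gcongr
    _ = 1 / 2 * ∫ θ, d θ ^ 2 ∂ψ + 1 / (32 * Z) * ∫ θ, d θ ^ 4 ∂ψ₀ := by
        rw [← mul_assoc, one_div_mul_one_div]
end
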